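/- Every left I₁-module of finite length is cyclic (generated by a single element), and every right I₁-module of finite length is cyclic. -/

import Mathlib

open Polynomial

noncomputable section
set_option synthInstance.maxHeartbeats 1000000
set_option maxHeartbeats 1000000
set_option linter.unusedSectionVars false

variable (K : Type*) [Field K] [CharZero K]

/-- The derivative operator `∂ = d/dx` on `K[x]`. -/
def derOp : Module.End K (Polynomial K) := Polynomial.derivative

/-- The multiplication-by-`x` operator on `K[x]`. -/
def xOp : Module.End K (Polynomial K) := LinearMap.mulLeft K Polynomial.X

/-- The integration operator `∫`, determined by `∫ xⁿ = xⁿ⁺¹/(n+1)`. -/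
def intOp : Module.End K (Polynomial K) :=
  (Polynomial.basisMonomials K).constr K fun n => ((n : K) + 1)⁻¹ • X ^ (n + 1)

/-- The algebra `I₁` of polynomial integro-differential operators: the subalgebra of
`End_K(K[x])` generated by `x`, `∂` and `∫`. -/
def I1 : Subalgebra K (Module.End K (Polynomial K)) :=
  Algebra.adjoin K {xOp K, derOp K, intOp K}

/-- `e_{ij} := ∫^i ∂^j − ∫^{i+1} ∂^{j+1}`. -/
def eOp (i j : ℕ) : Module.End K (Polynomial K) :=
  intOp K ^ i * derOp K ^ j - intOp K ^ (i + 1) * derOp K ^ (j + 1)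

/-- `F`, the `K`-linear span of the `e_{ij}`; it is the (two-sided) ideal of compact
operators of `I₁`. -/
def Fset : Submodule K (Module.End K (Polynomial K)) :=
  Submodule.span K {f | ∃ i j, f = eOp K i j}

lemma xOp_mem : xOp K ∈ I1 K := Algebra.subset_adjoin (by simp)
lemma derOp_mem : derOp K ∈ I1 K := Algebra.subset_adjoin (by simp)
lemma intOp_mem : intOp K ∈ I1 K := Algebra.subset_adjoin (by simp)

lemma eOp_mem (i j : ℕ) : eOp K i j ∈ I1 K :=
  sub_mem (mul_mem (pow_mem (intOp_mem K) i) (pow_mem (derOp_mem K) j))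
    (mul_mem (pow_mem (intOp_mem K) (i + 1)) (pow_mem (derOp_mem K) (j + 1)))

/-- `e_{ij}` as an element of the ring `I₁`. -/
def eI (i j : ℕ) : I1 K := ⟨eOp K i j, eOp_mem K i j⟩

/-- `∂` as an element of the ring `I₁`. -/
def derI : I1 K := ⟨derOp K, derOp_mem K⟩

/-- `∫` as an element of the ring `I₁`. -/
def intI : I1 K := ⟨intOp K, intOp_mem K⟩

/-- `H := ∂ ∘ x` (first multiply by `x`, then differentiate). -/
def hOp : Module.End K (Polynomial K) := derOp K * xOp K

/-- `K[H]`, the unital subalgebra of `I₁` generated by `H`. -/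
def KH : Subalgebra K (Module.End K (Polynomial K)) := Algebra.adjoin K {hOp K}

/-- The action of `a ∈ I₁` on a left `I₁`-module `M`, as a `K`-linear map `a_M : M → M`. -/
def actMap (a : I1 K) (M : Type*) [AddCommGroup M] [Module (I1 K) M] [Module K M]
    [SMulCommClass K (I1 K) M] : M →ₗ[K] M where
  toFun m := a • m
  map_add' := smul_add a
  map_smul' k m := (smul_comm k a m).symm

/-- Right multiplication `b ↦ b * a` in a ring `R`, as a homomorphism of left `R`-modules. -/
def rmulMap (R : Type*) [Ring R] (a : R) : R →ₗ[R] R where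
  toFun b := b * a
  map_add' b c := add_mul b c a
  map_smul' c b := by simp [smul_eq_mul, mul_assoc]

/-- Left multiplication `b ↦ a * b` in a ring `R`, as a homomorphism of right `R`-modules
(i.e. of left `Rᵐᵒᵖ`-modules). -/
def lmulMap (R : Type*) [Ring R] (a : R) : R →ₗ[Rᵐᵒᵖ] R where
  toFun b := a * b
  map_add' b c := mul_add a b c
  map_smul' c b := by simp [MulOpposite.smul_eq_mul_unop, mul_assoc]

/-- The centralizer `Cen_{I₁}(a) = {b ∈ I₁ : ab = ba}` of `a` in `I₁`, as a subalgebra of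
`End_K(K[x])`. -/
def Cen (a : Module.End K (Polynomial K)) : Subalgebra K (Module.End K (Polynomial K)) :=
  I1 K ⊓ Subalgebra.centralizer K {a}

/-- `Cen_F(a) = {f ∈ F : af = fa}`, a `K`-subspace of `End_K(K[x])`. -/
def CenF (a : Module.End K (Polynomial K)) : Submodule K (Module.End K (Polynomial K)) :=
  Fset K ⊓ Subalgebra.toSubmodule (Subalgebra.centralizer K {a})

section Abstract

variable {K} {R : Type*} [Ring R] [Algebra K R] {H I D : R}

lemma aeval_mul_of_shift (hHI : H * I = I * (H + 1)) (q : K[X]) :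
    aeval H q * I = I * aeval H (taylor 1 q) := by
  induction q using Polynomial.induction_on' with
  | add p q hp hq => simp [add_mul, mul_add, hp, hq]
  | monomial n a =>
    have h : ∀ n : ℕ, H ^ n * I = I * (H + 1) ^ n := by
      intro n
      induction n with
      | zero => simp
      | succ n ih => rw [pow_succ', mul_assoc, ih, ← mul_assoc, hHI, mul_assoc, ← pow_succ']
    simp [taylor_monomial, aeval_monomial, mul_assoc, h, Algebra.left_comm]

lemma mul_pow_of_shift (hHI : H * I = I * (H + 1)) (n : ℕ) :
    H * I ^ n = I ^ n * (H + (n : R)) := by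
  induction n with
  | zero => simp
  | succ n ih =>
    rw [pow_succ, ← mul_assoc, ih, mul_assoc, mul_assoc, add_mul, hHI, (Nat.cast_commute n I).eq]
    push_cast
    noncomm_ring

lemma taylor_one_sub_ne_zero {q : K[X]} (hq : 0 < q.natDegree) : taylor 1 q - q ≠ 0 := by
  intro h
  have h1 : taylor 1 q = q := sub_eq_zero.1 h
  have h2 : ∀ n : ℕ, q.eval (n : K) = q.eval 0 := by
    intro n
    induction n with
    | zero => simp
    | succ n ih =>
      rw [← ih]
      conv_rhs => rw [← h1, taylor_eval]
      push_cast
      rfl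
  have h3 : q = C (q.eval 0) := by
    apply Polynomial.eq_of_infinite_eval_eq
    apply (Set.infinite_range_of_injective (Nat.cast_injective (R := K))).mono
    rintro _ ⟨n, rfl⟩
    simp [h2 n]
  rw [h3] at hq
  simp at hq

lemma natDegree_taylor_one_sub_lt {q : K[X]} (hq : 0 < q.natDegree) :
    (taylor 1 q - q).natDegree < q.natDegree := by
  have h0 : q ≠ 0 := by rintro rfl; simp at hq
  apply natDegree_lt_natDegree (taylor_one_sub_ne_zero hq)
  rw [← degree_taylor q 1]
  apply degree_sub_lt_left (degree_taylor q 1)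
  · rwa [Ne, taylor_eq_zero]
  · exact leadingCoeff_taylor _ _

lemma one_mem_of_aeval_mem (hDI : D * I = 1) (hHI : H * I = I * (H + 1))
    (J : Ideal R) [J.IsTwoSided] {q : K[X]} (hq : q ≠ 0) (hJ : aeval H q ∈ J) :
    (1 : R) ∈ J := by
  induction hn : q.natDegree using Nat.strong_induction_on generalizing q with
  | _ n ih =>
    rcases Nat.eq_zero_or_pos q.natDegree with h0 | hpos
    · rw [eq_C_of_natDegree_eq_zero h0] at hJ hq
      have hc : q.coeff 0 ≠ 0 := by simpa using hq
      have := J.mul_mem_left (algebraMap K R (q.coeff 0)⁻¹) hJ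
      rwa [aeval_C, ← map_mul, inv_mul_cancel₀ hc, map_one] at this
    · refine ih _ (hn ▸ natDegree_taylor_one_sub_lt hpos) (taylor_one_sub_ne_zero hpos) ?_ rfl
      have h1 : D * (aeval H q * I) ∈ J := J.mul_mem_left _ (J.mul_mem_right _ hJ)
      rw [aeval_mul_of_shift hHI, ← mul_assoc, hDI, one_mul] at h1
      simpa using J.sub_mem h1 hJ

lemma one_mem_of_sum_mem (hDI : D * I = 1) (hHI : H * I = I * (H + 1))
    (J : Ideal R) [J.IsTwoSided] {S : Finset ℕ} (hS : S.Nonempty) (q : ℕ → K[X])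
    (hq : ∀ i ∈ S, q i ≠ 0) (hJ : ∑ i ∈ S, I ^ i * aeval H (q i) ∈ J) : (1 : R) ∈ J := by
  induction hS using Finset.Nonempty.cons_induction generalizing q with
  | singleton j =>
    rw [Finset.sum_singleton] at hJ
    have h := J.mul_mem_left (D ^ j) hJ
    have hD : ∀ n : ℕ, D ^ n * I ^ n = 1 := fun n => pow_mul_pow_eq_one n hDI
    rw [← mul_assoc, hD, one_mul] at h
    exact one_mem_of_aeval_mem hDI hHI J (hq j (by simp)) h
  | cons j S hj hS ih =>
    refine ih (fun i => C ((i : K) - j) * q i) ?_ ?_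
    · intro i hi
      refine mul_ne_zero ?_ (hq i (by simp [hi]))
      rw [Ne, C_eq_zero, sub_eq_zero, Nat.cast_inj]
      rintro rfl
      exact hj hi
    · have hterm : ∀ i : ℕ, H * (I ^ i * aeval H (q i)) - I ^ i * aeval H (q i) * H
          - (j : R) * (I ^ i * aeval H (q i)) = I ^ i * aeval H (C ((i : K) - j) * q i) := by
        intro i
        have hc : H * aeval H (q i) = aeval H (q i) * H := by
          have := congrArg (aeval H) (mul_comm X (q i))
          simpa using this
        rw [← mul_assoc, mul_pow_of_shift hHI, mul_assoc (I ^ i) (aeval H (q i)) H, ← hc,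
          ← mul_assoc (j : R), (Nat.cast_commute j (I ^ i)).eq]
        simp only [map_mul, map_sub, map_natCast]
        noncomm_ring
      have h := J.sub_mem (J.sub_mem (J.mul_mem_left H hJ) (J.mul_mem_right H hJ))
        (J.mul_mem_left (j : R) hJ)
      rw [Finset.mul_sum, Finset.sum_mul, Finset.mul_sum, ← Finset.sum_sub_distrib,
        ← Finset.sum_sub_distrib, Finset.sum_congr rfl fun i _ => hterm i,
        Finset.sum_cons] at h
      simpa using h

/-- The map `(qᵢ) ↦ ∑ Iⁱ qᵢ(H)`. -/
def normalForm (H I : R) : (ℕ →₀ K[X]) →ₗ[K] R :=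
  Finsupp.lsum K fun i => LinearMap.mulLeft K (I ^ i) ∘ₗ (aeval H).toLinearMap

lemma normalForm_apply (f : ℕ →₀ K[X]) :
    normalForm H I f = ∑ i ∈ f.support, I ^ i * aeval H (f i) := rfl

lemma normalForm_single (i : ℕ) (q : K[X]) :
    normalForm H I (Finsupp.single i q) = I ^ i * aeval H q := by
  simp [normalForm]

lemma eq_zero_of_normalForm_mem (hDI : D * I = 1) (hHI : H * I = I * (H + 1))
    (J : Ideal R) [J.IsTwoSided] (h1 : (1 : R) ∉ J) {f : ℕ →₀ K[X]}
    (hJ : normalForm H I f ∈ J) : f = 0 := by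
  by_contra hf
  exact h1 (one_mem_of_sum_mem hDI hHI J (Finsupp.support_nonempty_iff.2 hf) f
    (fun i hi => Finsupp.mem_support_iff.1 hi) hJ)

lemma normalForm_injective [Nontrivial R] (hDI : D * I = 1) (hHI : H * I = I * (H + 1)) :
    Function.Injective (normalForm (K := K) H I) :=
  (injective_iff_map_eq_zero _).2 fun f hf =>
    eq_zero_of_normalForm_mem hDI hHI ⊥ (by simp) (by simp [hf])

lemma exists_normalForm_of_mem_adjoin (hHI : H * I = I * (H + 1)) {a : R}
    (ha : a ∈ Algebra.adjoin K {H, I}) : ∃ f : ℕ →₀ K[X], normalForm H I f = a := by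
  suffices h : ∀ b, (∃ f : ℕ →₀ K[X], normalForm H I f = b) →
      ∃ f : ℕ →₀ K[X], normalForm H I f = a * b by
    simpa using h 1 ⟨Finsupp.single 0 1, by simp [normalForm_single]⟩
  change ∀ b ∈ LinearMap.range (normalForm H I), a * b ∈ LinearMap.range (normalForm H I)
  induction ha using Algebra.adjoin_induction with
  | algebraMap r =>
    intro b hb
    rw [← Algebra.smul_def]
    exact Submodule.smul_mem _ _ hb
  | add x y _ _ hx hy => exact fun b hb => add_mul x y b ▸ add_mem (hx b hb) (hy b hb)
  | mul x y _ _ hx hy => exact fun b hb => mul_assoc x y b ▸ hx _ (hy b hb)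
  | mem x hx =>
    rintro _ ⟨f, rfl⟩
    rw [normalForm_apply, Finset.mul_sum]
    refine Submodule.sum_mem _ fun i _ => ?_
    rcases hx with rfl | rfl
    · refine ⟨Finsupp.single i ((X + C (i : K)) * f i), ?_⟩
      rw [normalForm_single, ← mul_assoc, mul_pow_of_shift hHI]
      simp [mul_assoc]
    · exact ⟨Finsupp.single (i + 1) (f i), by rw [normalForm_single, pow_succ', mul_assoc]⟩

lemma exists_mul_pow_eq_pow_mul (hHI : H * I = I * (H + 1)) (n : ℕ) {a : R}
    (ha : a ∈ Algebra.adjoin K {H, I}) :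
    ∃ b ∈ Algebra.adjoin K {H, I}, a * I ^ n = I ^ n * b := by
  have hH : H ∈ Algebra.adjoin K {H, I} := Algebra.subset_adjoin (by simp)
  induction ha using Algebra.adjoin_induction with
  | algebraMap r => exact ⟨_, Subalgebra.algebraMap_mem _ r, Algebra.commutes r _⟩
  | add x y _ _ hx hy =>
    obtain ⟨x', hx', ex⟩ := hx
    obtain ⟨y', hy', ey⟩ := hy
    exact ⟨x' + y', add_mem hx' hy', by rw [add_mul, mul_add, ex, ey]⟩
  | mul x y _ _ hx hy =>
    obtain ⟨x', hx', ex⟩ := hx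
    obtain ⟨y', hy', ey⟩ := hy
    exact ⟨x' * y', mul_mem hx' hy', by rw [mul_assoc, ey, ← mul_assoc, ex, mul_assoc]⟩
  | mem x hx =>
    rcases hx with rfl | rfl
    · exact ⟨x + n, add_mem hH (natCast_mem _ n), mul_pow_of_shift hHI n⟩
    · exact ⟨x, Algebra.subset_adjoin (by simp), (pow_mul_comm' x n).symm⟩

lemma exists_mul_pow_mem_adjoin (hDI : D * I = 1) (hHI : H * I = I * (H + 1))
    (hgen : Algebra.adjoin K {H, I, D} = ⊤) (a : R) :
    ∃ n : ℕ, a * I ^ n ∈ Algebra.adjoin K {H, I} := by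
  have hI : I ∈ Algebra.adjoin K {H, I} := Algebra.subset_adjoin (by simp)
  have ha : a ∈ Algebra.adjoin K {H, I, D} := hgen ▸ Algebra.mem_top
  induction ha using Algebra.adjoin_induction with
  | algebraMap r => exact ⟨0, by simp⟩
  | add x y _ _ hx hy =>
    obtain ⟨n, hn⟩ := hx
    obtain ⟨m, hm⟩ := hy
    refine ⟨n + m, ?_⟩
    rw [add_mul, pow_add, ← mul_assoc, ← pow_add, add_comm n m, pow_add, ← mul_assoc]
    exact add_mem (mul_mem hn (pow_mem hI m)) (mul_mem hm (pow_mem hI n))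
  | mul x y _ _ hx hy =>
    obtain ⟨n, hn⟩ := hx
    obtain ⟨m, hm⟩ := hy
    obtain ⟨b, hb, eb⟩ := exists_mul_pow_eq_pow_mul hHI n hm
    refine ⟨m + n, ?_⟩
    rw [pow_add, ← mul_assoc, mul_assoc x y, mul_assoc x, eb, ← mul_assoc]
    exact mul_mem hn hb
  | mem x hx =>
    rcases hx with rfl | rfl | rfl
    · exact ⟨0, by simpa using Algebra.subset_adjoin (by simp)⟩
    · exact ⟨0, by simpa using hI⟩
    · exact ⟨1, by simp [hDI]⟩

lemma exists_normalForm_eq_mul_pow (hDI : D * I = 1) (hHI : H * I = I * (H + 1))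
    (hgen : Algebra.adjoin K {H, I, D} = ⊤) (a : R) :
    ∃ (n : ℕ) (f : ℕ →₀ K[X]), normalForm H I f = a * I ^ n :=
  let ⟨n, hn⟩ := exists_mul_pow_mem_adjoin hDI hHI hgen a
  ⟨n, exists_normalForm_of_mem_adjoin hHI hn⟩

/-- The left ideal of the elements annihilated by right multiplication by a power of `I`. -/
def powTorsion (I : R) : Ideal R where
  carrier := {a | ∃ n : ℕ, a * I ^ n = 0}
  zero_mem' := ⟨0, by simp⟩
  add_mem' := by
    rintro a b ⟨n, hn⟩ ⟨m, hm⟩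
    refine ⟨n + m, ?_⟩
    rw [add_mul, pow_add, ← mul_assoc, hn, ← pow_add, add_comm n m, pow_add, ← mul_assoc, hm]
    simp
  smul_mem' := by
    rintro c a ⟨n, hn⟩
    exact ⟨n, by rw [smul_eq_mul, mul_assoc, hn, mul_zero]⟩

lemma le_powTorsion_of_isTwoSided (hDI : D * I = 1) (hHI : H * I = I * (H + 1))
    (hgen : Algebra.adjoin K {H, I, D} = ⊤) (J : Ideal R) [J.IsTwoSided] (h1 : (1 : R) ∉ J) :
    J ≤ powTorsion I := by
  intro a ha
  obtain ⟨n, f, hf⟩ := exists_normalForm_eq_mul_pow hDI hHI hgen a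
  have h0 : f = 0 :=
    eq_zero_of_normalForm_mem hDI hHI J h1 (hf ▸ J.mul_mem_right _ ha)
  exact ⟨n, by rw [← hf, h0, map_zero]⟩

lemma normalForm_mul_add_natCast (f : ℕ →₀ K[X]) (n : ℕ) :
    normalForm H I f * (H + (n : R)) =
      normalForm H I (f.mapRange (fun q => q * (X + C (n : K))) (zero_mul _)) := by
  induction f using Finsupp.induction_linear with
  | zero => simp
  | add f g hf hg =>
    rw [map_add, add_mul, hf, hg, Finsupp.mapRange_add (fun p q => add_mul p q _), map_add]
  | single i q =>
    rw [Finsupp.mapRange_single, normalForm_single, normalForm_single]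
    simp [mul_assoc]

lemma eq_zero_of_mul_add_natCast_eq_zero [Nontrivial R] (hDI : D * I = 1)
    (hHI : H * I = I * (H + 1)) {f : ℕ →₀ K[X]} {n : ℕ}
    (h : normalForm H I f * (H + (n : R)) = 0) : f = 0 := by
  rw [normalForm_mul_add_natCast] at h
  have h0 := (injective_iff_map_eq_zero _).1 (normalForm_injective hDI hHI) _ h
  ext1 i
  have hi := DFunLike.congr_fun h0 i
  exact (mul_eq_zero.1 hi).resolve_right (X_add_C_ne_zero _)

lemma mul_add_natCast_ne_pow [Nontrivial R] (hDI : D * I = 1)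
    (hHI : H * I = I * (H + 1)) (f : ℕ →₀ K[X]) (n : ℕ) :
    normalForm H I f * (H + (n : R)) ≠ I ^ n := by
  intro h
  have h1 : I ^ n = normalForm H I (Finsupp.single n (1 : K[X])) := by simp [normalForm_single]
  rw [normalForm_mul_add_natCast, h1] at h
  have hi := DFunLike.congr_fun (normalForm_injective hDI hHI h) n
  simp only [Finsupp.mapRange_apply, Finsupp.single_eq_same] at hi
  exact not_isUnit_X_add_C (n : K) (.of_mul_eq_one_right _ hi)

lemma mul_mul_pow_of_shift (hHI : H * I = I * (H + 1)) (a : R) (n : ℕ) :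
    a * H * I ^ n = a * I ^ n * (H + (n : R)) := by
  rw [mul_assoc, mul_pow_of_shift hHI, mul_assoc]

lemma mul_mem_powTorsion_iff [Nontrivial R] (hDI : D * I = 1) (hHI : H * I = I * (H + 1))
    (hgen : Algebra.adjoin K {H, I, D} = ⊤) (a : R) :
    a * H ∈ powTorsion I ↔ a ∈ powTorsion I := by
  constructor
  · rintro ⟨n, hn⟩
    obtain ⟨m, f, hf⟩ := exists_normalForm_eq_mul_pow hDI hHI hgen (a * I ^ n)
    have h0 : a * H * I ^ (n + m) = 0 := by rw [pow_add, ← mul_assoc, hn, zero_mul]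
    rw [mul_mul_pow_of_shift hHI, pow_add, ← mul_assoc, ← hf] at h0
    refine ⟨n + m, ?_⟩
    rw [pow_add, ← mul_assoc, ← hf, eq_zero_of_mul_add_natCast_eq_zero hDI hHI h0, map_zero]
  · rintro ⟨n, hn⟩
    exact ⟨n, by rw [mul_mul_pow_of_shift hHI, hn, zero_mul]⟩

lemma not_isArtinian_quotient_powTorsion [Nontrivial R] (hDI : D * I = 1)
    (hHI : H * I = I * (H + 1)) (hgen : Algebra.adjoin K {H, I, D} = ⊤) :
    ¬ IsArtinian R (R ⧸ powTorsion I) := by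
  intro hA
  have hle : powTorsion I ≤ Submodule.comap (rmulMap R H) (powTorsion I) := fun a ha =>
    (mul_mem_powTorsion_iff hDI hHI hgen a).2 ha
  let φ : (R ⧸ powTorsion I) →ₗ[R] (R ⧸ powTorsion I) :=
    (powTorsion I).mapQ (powTorsion I) (rmulMap R H) hle
  have hinj : Function.Injective φ := by
    refine (injective_iff_map_eq_zero φ).2 fun y hy => ?_
    obtain ⟨a, rfl⟩ := Submodule.Quotient.mk_surjective _ y
    rw [Submodule.mapQ_apply, Submodule.Quotient.mk_eq_zero] at hy
    rw [Submodule.Quotient.mk_eq_zero]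
    exact (mul_mem_powTorsion_iff hDI hHI hgen a).1 hy
  obtain ⟨y, hy⟩ := IsArtinian.surjective_of_injective_endomorphism φ hinj
    (Submodule.Quotient.mk 1)
  obtain ⟨b, rfl⟩ := Submodule.Quotient.mk_surjective _ y
  rw [Submodule.mapQ_apply, Submodule.Quotient.eq] at hy
  obtain ⟨n, hn⟩ := hy
  have hn' : b * H * I ^ n = I ^ n := by
    rw [sub_mul, one_mul, sub_eq_zero] at hn
    exact hn
  obtain ⟨m, f, hf⟩ := exists_normalForm_eq_mul_pow hDI hHI hgen (b * I ^ n)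
  apply mul_add_natCast_ne_pow hDI hHI f (n + m)
  rw [hf, mul_assoc b, ← pow_add, ← mul_mul_pow_of_shift hHI, pow_add, ← mul_assoc, hn']

lemma exists_span_sup_eq_top_of_covBy [Nontrivial R] (hDI : D * I = 1)
    (hHI : H * I = I * (H + 1)) (hgen : Algebra.adjoin K {H, I, D} = ⊤)
    {M : Type*} [AddCommGroup M] [Module R M] [IsArtinian R M] {N N' : Submodule R M}
    (hN : N ⋖ N') {m : M} (hm : Submodule.span R {m} ⊔ N' = ⊤) :
    ∃ m' : M, Submodule.span R {m'} ⊔ N = ⊤ := by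
  by_contra! hcon
  have key : ∀ s ∈ N', (Submodule.span R {m + s} ⊔ N) ⊓ N' = N := by
    intro s hs
    refine (hN.eq_or_eq (le_inf le_sup_right hN.le) inf_le_right).resolve_right fun h => ?_
    have hN'le : N' ≤ Submodule.span R {m + s} ⊔ N := inf_eq_right.1 h
    refine hcon (m + s) (top_le_iff.1 (hm ▸ sup_le ?_ hN'le))
    rw [Submodule.span_singleton_le_iff_mem]
    have h1 : m + s ∈ Submodule.span R {m + s} ⊔ N :=
      Submodule.mem_sup_left (Submodule.mem_span_singleton_self _)
    simpa using sub_mem h1 (hN'le hs)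
  let J : Ideal R :=
    { carrier := {a | ∀ s ∈ N', a • s ∈ N}
      zero_mem' := fun s _ => by simp
      add_mem' := fun ha hb s hs => by
        rw [add_smul]
        exact add_mem (ha s hs) (hb s hs)
      smul_mem' := fun c a ha s hs => by
        rw [smul_assoc]
        exact N.smul_mem c (ha s hs) }
  have hJ : J.IsTwoSided := ⟨fun {a} b ha s hs => by
    rw [mul_smul]
    exact ha _ (N'.smul_mem b hs)⟩
  have h1 : (1 : R) ∉ J := fun h => hN.lt.not_ge fun s hs => by simpa using h s hs
  let ψ : R →ₗ[R] M ⧸ N := N.mkQ ∘ₗ LinearMap.toSpanSingleton R M m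
  have hker : LinearMap.ker ψ ≤ powTorsion I := by
    refine fun a ha => le_powTorsion_of_isTwoSided hDI hHI hgen J h1 fun s hs => ?_
    have ham : a • m ∈ N := (Submodule.Quotient.mk_eq_zero N).1 ha
    rw [← key s hs]
    refine ⟨?_, N'.smul_mem a hs⟩
    have h2 : a • (m + s) ∈ Submodule.span R {m + s} ⊔ N :=
      Submodule.mem_sup_left (Submodule.smul_mem _ _ (Submodule.mem_span_singleton_self _))
    simpa [smul_add] using sub_mem h2 (Submodule.mem_sup_right ham)
  apply not_isArtinian_quotient_powTorsion hDI hHI hgen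
  have : IsArtinian R (R ⧸ LinearMap.ker ψ) := isArtinian_of_linearEquiv ψ.quotKerEquivRange.symm
  exact isArtinian_of_surjective _ (Submodule.factor hker) (Submodule.factor_surjective hker)

theorem exists_span_singleton_eq_top_of_isFiniteLength [Nontrivial R] (hDI : D * I = 1)
    (hHI : H * I = I * (H + 1)) (hgen : Algebra.adjoin K {H, I, D} = ⊤)
    {M : Type*} [AddCommGroup M] [Module R M] (hM : IsFiniteLength R M) :
    ∃ m : M, Submodule.span R {m} = ⊤ := by
  obtain ⟨_, _⟩ := isFiniteLength_iff_isNoetherian_isArtinian.1 hM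
  suffices h : ∀ N : Submodule R M, ∃ m : M, Submodule.span R {m} ⊔ N = ⊤ by
    simpa using h ⊥
  intro N
  induction N using WellFoundedGT.induction with
  | ind N ih =>
    rcases eq_or_ne N ⊤ with rfl | hN
    · exact ⟨0, by simp⟩
    · obtain ⟨N', hcov, -⟩ := exists_covBy_le_of_lt hN.lt_top
      obtain ⟨m, hm⟩ := ih N' hcov.lt
      exact exists_span_sup_eq_top_of_covBy hDI hHI hgen hcov hm

end Abstract

lemma derOp_X_pow (n : ℕ) : derOp K (X ^ n) = (n : K) • X ^ (n - 1) := by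
  simp [derOp, derivative_X_pow, smul_eq_C_mul]

lemma xOp_X_pow (n : ℕ) : xOp K (X ^ n) = X ^ (n + 1) := by
  simp [xOp, pow_succ']

lemma intOp_X_pow (n : ℕ) : intOp K (X ^ n) = ((n : K) + 1)⁻¹ • X ^ (n + 1) := by
  have h := (Polynomial.basisMonomials K).constr_basis K
    (fun n : ℕ => ((n : K) + 1)⁻¹ • (X : K[X]) ^ (n + 1)) n
  simpa only [intOp, coe_basisMonomials, monomial_one_right_eq_X_pow] using h

lemma hOp_X_pow (n : ℕ) : hOp K (X ^ n) = ((n : K) + 1) • X ^ n := by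
  rw [hOp, Module.End.mul_apply, xOp_X_pow, derOp_X_pow]
  simp

variable {K} in
lemma end_ext_X_pow {f g : Module.End K K[X]} (h : ∀ n : ℕ, f (X ^ n) = g (X ^ n)) : f = g :=
  (Polynomial.basisMonomials K).ext fun n => by
    simpa [coe_basisMonomials, monomial_one_right_eq_X_pow] using h n

lemma derOp_mul_intOp : derOp K * intOp K = 1 := by
  refine end_ext_X_pow fun n => ?_
  have : (n : K) + 1 ≠ 0 := Nat.cast_add_one_ne_zero n
  rw [Module.End.mul_apply, intOp_X_pow, map_smul, derOp_X_pow, smul_smul]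
  simp [this]

lemma hOp_mul_intOp : hOp K * intOp K = intOp K * (hOp K + 1) := by
  refine end_ext_X_pow fun n => ?_
  simp only [Module.End.mul_apply, LinearMap.add_apply, Module.End.one_apply, intOp_X_pow,
    hOp_X_pow, map_smul, map_add, smul_smul, ← add_smul]
  congr 1
  push_cast
  ring

lemma derOp_mul_hOp : derOp K * hOp K = (hOp K + 1) * derOp K := by
  refine end_ext_X_pow fun n => ?_
  rcases n with _ | n
  · have h : hOp K 1 = 1 := by simpa using hOp_X_pow K 0
    simp [h, derOp]
  · simp only [Module.End.mul_apply, LinearMap.add_apply, Module.End.one_apply, derOp_X_pow,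
      hOp_X_pow, map_smul, smul_smul, ← add_smul, smul_add, Nat.add_sub_cancel]
    congr 1
    push_cast
    ring

lemma intOp_mul_hOp : intOp K * hOp K = xOp K := by
  refine end_ext_X_pow fun n => ?_
  have : (n : K) + 1 ≠ 0 := Nat.cast_add_one_ne_zero n
  rw [Module.End.mul_apply, hOp_X_pow, map_smul, intOp_X_pow, xOp_X_pow, smul_smul,
    mul_inv_cancel₀ this, one_smul]

/-- `H` as an element of the ring `I₁`. -/
def hI : I1 K := ⟨hOp K, mul_mem (derOp_mem K) (xOp_mem K)⟩

lemma adjoin_hI_intI_derI : Algebra.adjoin K {hI K, intI K, derI K} = ⊤ := by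
  refine Subalgebra.map_injective (f := (I1 K).val) Subtype.val_injective ?_
  rw [AlgHom.map_adjoin, Algebra.map_top, Subalgebra.range_val]
  have himg : (I1 K).val '' {hI K, intI K, derI K} = {hOp K, intOp K, derOp K} := by
    simp [Set.image_insert_eq, hI, intI, derI]
  rw [himg]
  apply le_antisymm
  · rw [Algebra.adjoin_le_iff]
    rintro _ (rfl | rfl | rfl)
    exacts [(hI K).2, intOp_mem K, derOp_mem K]
  · rw [I1, Algebra.adjoin_le_iff]
    rintro _ (rfl | rfl | rfl)
    · rw [← intOp_mul_hOp]
      exact mul_mem (Algebra.subset_adjoin (by simp)) (Algebra.subset_adjoin (by simp))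
    · exact Algebra.subset_adjoin (by simp)
    · exact Algebra.subset_adjoin (by simp)

lemma adjoin_op_hI_derI_intI :
    Algebra.adjoin K {MulOpposite.op (hI K), MulOpposite.op (derI K), MulOpposite.op (intI K)}
      = ⊤ := by
  have h := congrArg Subalgebra.op (adjoin_hI_intI_derI K)
  rw [Subalgebra.op_adjoin, Subalgebra.op_top] at h
  rw [← h]
  congr 1
  ext a
  rw [Set.mem_preimage]
  simp only [Set.mem_insert_iff, Set.mem_singleton_iff, ← MulOpposite.unop_inj,
    MulOpposite.unop_op]
  tauto

/-- every left (resp. right) `I₁`-module of finite length is cyclic. -/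
theorem statement10 :
    (∀ (M : Type*) [AddCommGroup M] [Module (I1 K) M], IsFiniteLength (I1 K) M →
      ∃ m : M, Submodule.span (I1 K) {m} = ⊤)
    ∧ (∀ (M : Type*) [AddCommGroup M] [Module ((I1 K)ᵐᵒᵖ) M],
        IsFiniteLength ((I1 K)ᵐᵒᵖ) M →
      ∃ m : M, Submodule.span ((I1 K)ᵐᵒᵖ) {m} = ⊤) := by
  have hDI : derI K * intI K = 1 := Subtype.ext (derOp_mul_intOp K)
  have hHI : hI K * intI K = intI K * (hI K + 1) := Subtype.ext (hOp_mul_intOp K)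
  have hDH : derI K * hI K = (hI K + 1) * derI K := Subtype.ext (derOp_mul_hOp K)
  have hDI' : MulOpposite.op (intI K) * MulOpposite.op (derI K) = 1 := by
    rw [← MulOpposite.op_mul, hDI, MulOpposite.op_one]
  have hHD' : MulOpposite.op (hI K) * MulOpposite.op (derI K) =
      MulOpposite.op (derI K) * (MulOpposite.op (hI K) + 1) := by
    rw [← MulOpposite.op_mul, hDH, MulOpposite.op_mul, MulOpposite.op_add, MulOpposite.op_one]
  exact ⟨fun M _ _ hM =>
      exists_span_singleton_eq_top_of_isFiniteLength hDI hHI (adjoin_hI_intI_derI K) hM,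
    fun M _ _ hM =>
      exists_span_singleton_eq_top_of_isFiniteLength hDI' hHD' (adjoin_op_hI_derI_intI K) hM⟩

end
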